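/- Let f : S → S̃ be a homeomorphism between relative Schottky sets S = Ω \ ⋃_{i∈I} B_i and S̃ = Ω̃ \ ⋃_{j∈J} B̃_j in domains Ω, Ω̃ ⊆ ℂ. Then for every i ∈ I there exists j ∈ J such that f(∂B_i) = ∂B̃_j; that is, f maps every peripheral circle of S onto a peripheral circle of S̃. -/

import Mathlib

open Set Metric MeasureTheory Filter
open scoped NNReal ENNReal Topology

noncomputable section

/-- A (nonempty, open, connected) domain in the complex plane. -/
def IsPlaneDomain (Ω : Set ℂ) : Prop := IsOpen Ω ∧ IsConnected Ω

/-- A family of open round discs (given by centers `c` and radii `r`) whose closures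
are contained in `Ω` and are pairwise disjoint. -/
def IsSchottkyFamily {I : Type*} (Ω : Set ℂ) (c : I → ℂ) (r : I → ℝ) : Prop :=
  (∀ i, 0 < r i) ∧ (∀ i, closedBall (c i) (r i) ⊆ Ω) ∧
    Pairwise fun i j => Disjoint (closedBall (c i) (r i)) (closedBall (c j) (r j))

/-- `S` is a relative Schottky set in the domain `Ω`. -/
def IsRelativeSchottkySet (Ω S : Set ℂ) : Prop :=
  IsPlaneDomain Ω ∧
    ∃ (I : Type) (c : I → ℂ) (r : I → ℝ),
      IsSchottkyFamily Ω c r ∧ S = Ω \ ⋃ i, ball (c i) (r i)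

/-- A Jordan domain: a bounded domain whose boundary is an embedded circle, and which is
a connected component of the complement of its boundary. -/
def IsJordanDomain (Ω : Set ℂ) : Prop :=
  IsPlaneDomain Ω ∧ Bornology.IsBounded Ω ∧
    (∃ γ : ℂ → ℂ, ContinuousOn γ (sphere (0 : ℂ) 1) ∧ InjOn γ (sphere (0 : ℂ) 1) ∧
      γ '' sphere (0 : ℂ) 1 = frontier Ω) ∧
    ∀ p ∈ Ω, connectedComponentIn (frontier Ω)ᶜ p = Ω

/-- `f : ℂ → ℂ` restricts to a homeomorphism from `S` onto `T`. -/
def IsHomeoOn (f : ℂ → ℂ) (S T : Set ℂ) : Prop :=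
  ∃ e : S ≃ₜ T, ∀ z : S, (e z : ℂ) = f (z : ℂ)

/-- `f` is `η`-quasisymmetric on `X`. -/
def QuasisymmetricWith (η : ℝ≥0 ≃ₜ ℝ≥0) (f : ℂ → ℂ) (X : Set ℂ) : Prop :=
  ∀ p ∈ X, ∀ q ∈ X, ∀ s ∈ X, ∀ t : ℝ≥0,
    dist p q ≤ (t : ℝ) * dist p s → dist (f p) (f q) ≤ (η t : ℝ) * dist (f p) (f s)

/-- `f` is locally quasisymmetric on `X`: its restriction to every compact subset of `X`
is quasisymmetric. -/
def LocallyQuasisymmetricOn (f : ℂ → ℂ) (X : Set ℂ) : Prop :=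
  ∀ K ⊆ X, IsCompact K → ∃ η : ℝ≥0 ≃ₜ ℝ≥0, QuasisymmetricWith η f K

/-- `f` is locally bi-Lipschitz on `S`. -/
def LocallyBiLipschitzOn (f : ℂ → ℂ) (S : Set ℂ) : Prop :=
  ∀ p ∈ S, ∃ U ∈ 𝓝[S] p, ∃ L : ℝ, 1 ≤ L ∧
    ∀ x ∈ U, ∀ y ∈ U,
      dist x y / L ≤ dist (f x) (f y) ∧ dist (f x) (f y) ≤ L * dist x y

/-- A circle admits no continuous injection into the real line. -/
theorem not_injOn_sphere_of_continuousOn_real {c : ℂ} {r : ℝ} (hr : 0 < r) {g : ℂ → ℝ}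
    (hg : ContinuousOn g (sphere c r)) : ¬ InjOn g (sphere c r) := by
  intro hinj
  have hmem (θ : ℝ) : circleMap c r θ ∈ sphere c r := circleMap_mem_sphere c hr.le θ
  have hcont : Continuous fun θ : ℝ => g (circleMap c r θ) :=
    hg.comp_continuous (continuous_circleMap c r) hmem
  let h : ℝ → ℝ := fun θ => g (circleMap c r θ) - g (circleMap c r (θ + Real.pi))
  have hh : Continuous h := hcont.sub (hcont.comp (continuous_id.add continuous_const))
  have hpi : h Real.pi = -h 0 := by
    have : circleMap c r (Real.pi + Real.pi) = circleMap c r 0 := by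
      rw [← two_mul, ← zero_add (2 * Real.pi), periodic_circleMap c r 0]
    simp [h, this]
  obtain ⟨θ, hθ⟩ : ∃ θ, h θ = 0 := by
    rcases le_total (h 0) 0 with h0 | h0
    · exact mem_range_of_exists_le_of_exists_ge hh ⟨0, h0⟩ ⟨Real.pi, by linarith⟩
    · exact mem_range_of_exists_le_of_exists_ge hh ⟨Real.pi, by linarith⟩ ⟨0, h0⟩
  have heq := hinj (hmem _) (hmem _) (sub_eq_zero.1 hθ)
  have : (r : ℂ) * Complex.exp (θ * Complex.I) = 0 := by
    simp only [circleMap, Complex.ofReal_add, add_mul, Complex.exp_add, Complex.exp_pi_mul_I] at heq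
    linear_combination heq / 2
  simp [hr.ne'] at this

/-- A continuous injection of a circle into a circle is onto. -/
theorem sphere_subset_image_of_injOn {c c' : ℂ} {r r' : ℝ} (hr : 0 < r) (hr' : 0 < r')
    {g : ℂ → ℂ} (hg : ContinuousOn g (sphere c r)) (hinj : InjOn g (sphere c r))
    (hmaps : MapsTo g (sphere c r) (sphere c' r')) : sphere c' r' ⊆ g '' sphere c r := by
  intro p hp
  by_contra hpg
  have hpc : p - c' ≠ 0 := by
    rw [← norm_pos_iff, ← dist_eq_norm, mem_sphere.1 hp]; exact hr'
  have hnorm {z : ℂ} (hz : z ∈ sphere c' r') : ‖-(z - c') / (p - c')‖ = 1 := by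
    rw [norm_div, norm_neg, ← dist_eq_norm, ← dist_eq_norm, mem_sphere.1 hz, mem_sphere.1 hp,
      div_self hr'.ne']
  have hslit {z : ℂ} (hz : z ∈ sphere c' r') (hzp : z ≠ p) :
      -(z - c') / (p - c') ∈ Complex.slitPlane := by
    rw [Complex.mem_slitPlane_iff_arg]
    refine ⟨fun harg => hzp ?_, fun h0 => ?_⟩
    · have := Complex.norm_mul_exp_arg_mul_I (-(z - c') / (p - c'))
      rw [hnorm hz, harg, Complex.exp_pi_mul_I, eq_div_iff hpc] at this
      push_cast at this
      linear_combination this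
    · have := hnorm hz
      rw [h0, norm_zero] at this
      exact zero_ne_one this
  have hne {z : ℂ} (hz : z ∈ sphere c r) : g z ≠ p := fun h => hpg ⟨z, hz, h⟩
  refine not_injOn_sphere_of_continuousOn_real (c := c) hr
    (g := fun z => Complex.arg (-(g z - c') / (p - c'))) ?_ ?_
  · have hquot : ContinuousOn (fun z => -(g z - c') / (p - c')) (sphere c r) := by fun_prop
    exact fun z hz => ContinuousAt.comp_continuousWithinAt (g := Complex.arg)
      (Complex.continuousAt_arg (hslit (hmaps hz) (hne hz))) (hquot z hz)
  · intro z hz w hw hzw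
    apply hinj hz hw
    have := Complex.ext_norm_arg ((hnorm (hmaps hz)).trans (hnorm (hmaps hw)).symm) hzw
    rw [div_left_inj' hpc] at this
    linear_combination -this

/-- Off a path, the quotient of the differences with its endpoints has a continuous logarithm. -/
theorem exists_continuousOn_log_div_sub (γ : C(unitInterval, ℂ)) :
    ∃ L : ℂ → ℂ, ContinuousOn L (range γ)ᶜ ∧
      ∀ z ∉ range γ, Complex.exp (L z) = (z - γ 1) / (z - γ 0) := by
  have hsub (z : ↥(range γ)ᶜ) (t : unitInterval) : (z : ℂ) - γ t ≠ 0 :=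
    sub_ne_zero.2 fun h => z.2 ⟨t, h.symm⟩
  let H : C(unitInterval × ↥(range γ)ᶜ, {z : ℂ // z ≠ 0}) :=
    ⟨fun p => ⟨(p.2 - γ p.1) / (p.2 - γ 0), div_ne_zero (hsub _ _) (hsub _ _)⟩, by
      refine Continuous.subtype_mk (Continuous.div (by fun_prop) (by fun_prop) ?_) _
      exact fun p => hsub _ _⟩
  have hH (z) : H (0, z) = ⟨Complex.exp ((0 : C(↥(range γ)ᶜ, ℂ)) z), Complex.exp_ne_zero _⟩ := by
    simp [H, div_self (hsub z 0)]
  let lift := Complex.isCoveringMap_exp.liftHomotopy H 0 hH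
  classical
  refine ⟨fun z => if h : z ∈ (range γ)ᶜ then lift (1, ⟨z, h⟩) else 0, ?_, fun z hz => ?_⟩
  · rw [continuousOn_iff_continuous_domRestrict]
    have : Continuous fun z : ↥(range γ)ᶜ => lift (1, z) := by fun_prop
    convert this using 2 with z
    exact dif_pos z.2
  · have hz' : z ∈ (range γ)ᶜ := hz
    have := congrFun (Complex.isCoveringMap_exp.liftHomotopy_lifts H 0 hH) (1, ⟨z, hz'⟩)
    refine (congrArg Complex.exp (dif_pos hz')).trans (congrArg Subtype.val this)

/-- On the plane punctured at two distinct points, the quotient of the differences with these points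
has no continuous logarithm. -/
theorem not_exists_continuousOn_log_div_sub {a b : ℂ} (hab : a ≠ b) {L : ℂ → ℂ}
    (hL : ContinuousOn L {a, b}ᶜ) :
    ¬ ∀ z ∈ ({a, b} : Set ℂ)ᶜ, Complex.exp (L z) = (z - b) / (z - a) := by
  intro hexp
  have hab' : a - b ≠ 0 := sub_ne_zero.2 hab
  have hpos : 0 < ‖a - b‖ := norm_pos_iff.2 hab'
  set ρ := ‖a - b‖ / 2 with hρ
  have hρ0 : 0 < ρ := by positivity
  have hnorm {z : ℂ} (hz : z ∈ sphere a ρ) : ‖(z - a) / (a - b)‖ = 1 / 2 := by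
    rw [norm_div, ← dist_eq_norm, mem_sphere.1 hz, hρ]; field_simp
  have hmem {z : ℂ} (hz : z ∈ sphere a ρ) : z ∈ ({a, b} : Set ℂ)ᶜ := by
    rintro (rfl | rfl)
    · have := hnorm hz; norm_num at this
    · have := hnorm hz
      rw [← neg_sub a z, neg_div, div_self hab'] at this; norm_num at this
  have hslit {z : ℂ} (hz : z ∈ sphere a ρ) : 1 + (z - a) / (a - b) ∈ Complex.slitPlane :=
    Complex.mem_slitPlane_of_norm_lt_one (by rw [hnorm hz]; norm_num)
  let G : ℂ → ℂ := fun z => Complex.log (1 + (z - a) / (a - b)) - L z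
  have hG : ContinuousOn G (sphere a ρ) := by
    refine ContinuousOn.sub (ContinuousOn.clog (by fun_prop) fun z hz => hslit hz)
      (hL.mono fun z hz => hmem hz)
  have hGexp {z : ℂ} (hz : z ∈ sphere a ρ) : Complex.exp (G z) = (z - a) / (a - b) := by
    have hm := hmem hz
    simp only [mem_compl_iff, mem_insert_iff, mem_singleton_iff, not_or] at hm
    have h1 := sub_ne_zero.2 hm.1
    have h2 := sub_ne_zero.2 hm.2
    rw [Complex.exp_sub, Complex.exp_log (Complex.slitPlane_ne_zero (hslit hz)), hexp z (hmem hz)]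
    field_simp
    ring
  have hre {z : ℂ} (hz : z ∈ sphere a ρ) : (G z).re = Real.log (1 / 2) := by
    rw [← hnorm hz, ← hGexp hz, Complex.norm_exp, Real.log_exp]
  refine not_injOn_sphere_of_continuousOn_real hρ0 (g := fun z => (G z).im)
    (Complex.continuous_im.comp_continuousOn hG) fun z hz w hw hzw => ?_
  have : G z = G w := Complex.ext ((hre hz).trans (hre hw).symm) hzw
  have := congrArg Complex.exp this
  rw [hGexp hz, hGexp hw, div_left_inj' hab'] at this
  linear_combination this

/-- Two paths with the same distinct endpoints which meet only at the endpoints separate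
the plane. -/
theorem not_isPreconnected_compl_range_union_range {γ₁ γ₂ : C(unitInterval, ℂ)} (h0 : γ₁ 0 = γ₂ 0)
    (h1 : γ₁ 1 = γ₂ 1) (hne : γ₁ 0 ≠ γ₁ 1)
    (hinter : range γ₁ ∩ range γ₂ ⊆ {γ₁ 0, γ₁ 1}) :
    ¬ IsPreconnected (range γ₁ ∪ range γ₂)ᶜ := by
  intro hC
  obtain ⟨L₁, hL₁, hexp₁⟩ := exists_continuousOn_log_div_sub γ₁
  obtain ⟨L₂, hL₂, hexp₂⟩ := exists_continuousOn_log_div_sub γ₂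
  rw [← h0, ← h1] at hexp₂
  have hopen₁ : IsOpen (range γ₁)ᶜ := (isCompact_range γ₁.continuous).isClosed.isOpen_compl
  have hopen₂ : IsOpen (range γ₂)ᶜ := (isCompact_range γ₂.continuous).isClosed.isOpen_compl
  have hdiff : MapsTo (fun z => L₁ z - L₂ z) (range γ₁ ∪ range γ₂)ᶜ
      ((fun z : ℂ => (⟨_, z.exp_ne_zero⟩ : {z : ℂ // z ≠ 0})) ⁻¹' {⟨1, one_ne_zero⟩}) := by
    intro z hz
    simp only [mem_compl_iff, mem_union, not_or] at hz
    have hn0 : z - γ₁ 0 ≠ 0 := sub_ne_zero.2 fun h => hz.1 ⟨0, h.symm⟩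
    have hn1 : z - γ₁ 1 ≠ 0 := sub_ne_zero.2 fun h => hz.1 ⟨1, h.symm⟩
    refine Subtype.ext ?_
    change Complex.exp (L₁ z - L₂ z) = 1
    rw [Complex.exp_sub, hexp₁ z hz.1, hexp₂ z hz.2, div_self (div_ne_zero hn1 hn0)]
  obtain ⟨k, hk1, hk⟩ : ∃ k : ℂ, Complex.exp k = 1 ∧
      ∀ z ∈ (range γ₁ ∪ range γ₂)ᶜ, L₁ z = L₂ z + k := by
    rcases (range γ₁ ∪ range γ₂)ᶜ.eq_empty_or_nonempty with he | ⟨w, hw⟩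
    · exact ⟨0, Complex.exp_zero, by simp [he]⟩
    · refine ⟨L₁ w - L₂ w, congrArg Subtype.val (hdiff hw), fun z hz => ?_⟩
      have := hC.constant_of_mapsTo ⟨(Complex.isCoveringMap_exp ⟨1, one_ne_zero⟩).1⟩
        ((hL₁.mono (compl_subset_compl.2 subset_union_left)).sub
          (hL₂.mono (compl_subset_compl.2 subset_union_right))) hdiff hz hw
      simp only [Pi.sub_apply] at this
      linear_combination this
  classical
  let L : ℂ → ℂ := fun z => if z ∈ range γ₁ then L₂ z + k else L₁ z
  have hLeq {z : ℂ} (hz : z ∉ range γ₂) : L z = L₂ z + k := by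
    by_cases hz₁ : z ∈ range γ₁
    · exact if_pos hz₁
    · exact (if_neg hz₁).trans (hk z (by simp only [mem_compl_iff, mem_union]; tauto))
  have hcase {z : ℂ} (hz : z ∈ ({γ₁ 0, γ₁ 1} : Set ℂ)ᶜ) : z ∉ range γ₁ ∨ z ∉ range γ₂ := by
    by_contra! h
    exact hz (hinter h)
  refine not_exists_continuousOn_log_div_sub hne (L := L) (fun z hz => ?_) fun z hz => ?_
  · refine ContinuousAt.continuousWithinAt ?_
    rcases hcase hz with h | h
    · refine (hL₁.continuousAt (hopen₁.mem_nhds h)).congr ?_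
      filter_upwards [hopen₁.mem_nhds h] with w hw using (if_neg hw).symm
    · refine ((hL₂.continuousAt (hopen₂.mem_nhds h)).add (continuousAt_const (y := k))).congr ?_
      filter_upwards [hopen₂.mem_nhds h] with w hw using (hLeq hw).symm
  · rcases hcase hz with h | h
    · rw [← hexp₁ z h]; exact congrArg _ (if_neg h)
    · rw [hLeq h, Complex.exp_add, hk1, mul_one, hexp₂ z h]

/-- The complement of a Jordan curve is disconnected. -/
theorem not_isPreconnected_compl_image_sphere {c : ℂ} {r : ℝ} (hr : 0 < r) {f : ℂ → ℂ}
    (hf : ContinuousOn f (sphere c r)) (hinj : InjOn f (sphere c r)) :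
    ¬ IsPreconnected (f '' sphere c r)ᶜ := by
  have hmem (θ : ℝ) : circleMap c r θ ∈ sphere c r := circleMap_mem_sphere c hr.le θ
  have hcont : Continuous fun θ : ℝ => f (circleMap c r θ) :=
    hf.comp_continuous (continuous_circleMap c r) hmem
  let γ₁ : C(unitInterval, ℂ) := ⟨fun t => f (circleMap c r (Real.pi * t)),
    hcont.comp (continuous_const.mul continuous_subtype_val)⟩
  let γ₂ : C(unitInterval, ℂ) := ⟨fun t => f (circleMap c r (-(Real.pi * t))),
    hcont.comp (continuous_const.mul continuous_subtype_val).neg⟩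
  have hpi := Real.pi_pos
  have h1 : γ₁ 1 = γ₂ 1 := by
    have := periodic_circleMap c r (-Real.pi)
    rw [show -Real.pi + 2 * Real.pi = Real.pi by ring] at this
    simp [γ₁, γ₂, this]
  have hunion : range γ₁ ∪ range γ₂ = f '' sphere c r := by
    apply Subset.antisymm
    · rintro _ (⟨t, rfl⟩ | ⟨t, rfl⟩) <;> exact mem_image_of_mem f (hmem _)
    · rintro _ ⟨z, hz, rfl⟩
      rw [← abs_of_pos hr, ← range_circleMap, ← (periodic_circleMap c r).image_Ioc
        Real.two_pi_pos (-Real.pi)] at hz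
      obtain ⟨θ, ⟨hθ₁, hθ₂⟩, rfl⟩ := hz
      rcases le_total 0 θ with h | h
      · refine Or.inl ⟨⟨θ / Real.pi, by positivity, (div_le_one hpi).2 (by linarith)⟩, ?_⟩
        simp [γ₁, mul_div_cancel₀ _ hpi.ne']
      · refine Or.inr ⟨⟨-θ / Real.pi, div_nonneg (by linarith) hpi.le,
          (div_le_one hpi).2 (by linarith)⟩, ?_⟩
        simp [γ₂, mul_div_cancel₀ _ hpi.ne']
  rw [← hunion]
  refine not_isPreconnected_compl_range_union_range (by simp [γ₁, γ₂]) h1 ?_ ?_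
  · intro h
    have := hinj (hmem _) (hmem _) h
    rw [circleMap_eq_circleMap_iff c hr.ne'] at this
    obtain ⟨n, hn⟩ := this
    have := congrArg Complex.im hn
    simp at this
    have h2 : ((1 + 2 * n : ℤ) : ℝ) * Real.pi = 0 := by push_cast; linarith
    have h3 : 1 + 2 * n = 0 := by exact_mod_cast (mul_eq_zero.1 h2).resolve_right hpi.ne'
    omega
  · rintro _ ⟨⟨t, rfl⟩, ⟨s, hs⟩⟩
    have := hinj (hmem _) (hmem _) hs
    rw [circleMap_eq_circleMap_iff c hr.ne'] at this
    obtain ⟨n, hn⟩ := this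
    have := congrArg Complex.im hn
    simp at this
    have h2 : (t : ℝ) + s = -(2 * n) := by
      apply mul_left_cancel₀ hpi.ne'; linarith
    have ht := t.2
    have hs' := s.2
    have hn0 : n ≤ 0 := by
      by_contra! h
      have : (1 : ℝ) ≤ n := by exact_mod_cast h
      linarith [ht.1, hs'.1]
    have hn1 : -1 ≤ n := by
      by_contra! h
      have : (n : ℝ) ≤ -2 := by exact_mod_cast (by omega : n ≤ -2)
      linarith [ht.2, hs'.2]
    obtain rfl | rfl : n = 0 ∨ n = -1 := by omega
    · left
      congr 1
      apply Subtype.ext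
      push_cast at h2
      change (t : ℝ) = 0
      linarith [ht.1, hs'.1]
    · right
      congr 1
      apply Subtype.ext
      push_cast at h2
      change (t : ℝ) = 1
      linarith [ht.2, hs'.2]

theorem isPreconnected_sphere_complex (c : ℂ) (r : ℝ) : IsPreconnected (sphere c r) :=
  isPreconnected_sphere (by rw [Complex.rank_real_complex]; norm_num) c r

/-- A preconnected set which meets a ball and its complement meets the bounding sphere. -/
theorem IsPreconnected.inter_sphere_nonempty {s : Set ℂ} (hs : IsPreconnected s) {c : ℂ} {r : ℝ}
    (hin : (s ∩ ball c r).Nonempty) (hout : ¬ s ⊆ ball c r) : (s ∩ sphere c r).Nonempty := by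
  by_contra hempty
  refine hout (hs.subset_of_closure_inter_subset isOpen_ball hin fun z hz => ?_)
  refine (lt_or_eq_of_le (mem_closedBall.1 (closure_ball_subset_closedBall hz.1))).resolve_right fun h => ?_
  exact hempty ⟨z, hz.2, h⟩

/-- Removing a closed round disc from a connected open set leaves a connected set. -/
theorem IsPreconnected.diff_closedBall {Ω : Set ℂ} (hΩ : IsOpen Ω) (hconn : IsPreconnected Ω)
    {c : ℂ} {r : ℝ} (hr : 0 < r) (hsub : closedBall c r ⊆ Ω) :
    IsPreconnected (Ω \ closedBall c r) := by
  obtain ⟨δ, hδ, hthick⟩ := (isCompact_closedBall c r).exists_thickening_subset_open hΩ hsub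
  rw [thickening_closedBall hδ hr.le] at hthick
  set R := δ + r
  have hannulus : IsPreconnected (ball c R \ closedBall c r) := by
    have : ball c R \ closedBall c r =
        (fun p : ℝ × ℝ => circleMap c p.1 p.2) '' (Ioo r R ×ˢ univ) := by
      ext z
      constructor
      · rintro ⟨hzR, hzr⟩
        rw [mem_closedBall, not_le] at hzr
        have hz : z ∈ sphere c |dist z c| := by simp [dist_eq_norm]
        rw [← range_circleMap] at hz
        obtain ⟨θ, hθ⟩ := hz
        exact ⟨(dist z c, θ), ⟨⟨hzr, hzR⟩, mem_univ _⟩, hθ⟩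
      · rintro ⟨⟨ρ, θ⟩, ⟨⟨h1, h2⟩, -⟩, rfl⟩
        have : dist (circleMap c ρ θ) c = ρ := circleMap_mem_sphere c (hr.trans h1).le θ
        exact ⟨by simpa only [mem_ball, this] using h2,
          by simpa only [mem_closedBall, this, not_le] using h1⟩
    rw [this]
    refine (isPreconnected_Ioo.prod isPreconnected_univ).image _ (Continuous.continuousOn ?_)
    unfold circleMap
    fun_prop
  have hopen : IsOpen (Ω \ closedBall c r) := hΩ.sdiff isClosed_closedBall
  have key {u v : Set ℂ} (hu : IsOpen u) (hv : IsOpen v) (hcov : Ω \ closedBall c r ⊆ u ∪ v)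
      (hdisj : Ω \ closedBall c r ∩ (u ∩ v) = ∅) (hann : ball c R \ closedBall c r ⊆ u) :
      Ω \ closedBall c r ⊆ u := by
    have hd {z : ℂ} (hz : z ∈ Ω \ closedBall c r) (hzu : z ∈ u) : z ∉ v := fun hzv =>
      eq_empty_iff_forall_notMem.1 hdisj z ⟨hz, hzu, hzv⟩
    have := hconn.subset_left_of_subset_union (u := ball c R ∪ (Ω \ closedBall c r ∩ u))
      (v := Ω \ closedBall c r ∩ v) (isOpen_ball.union (hopen.inter hu)) (hopen.inter hv) ?_ ?_ ?_
    · intro z hz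
      rcases this hz.1 with h | h
      · exact hann ⟨h, hz.2⟩
      · exact h.2
    · rw [Set.disjoint_left]
      rintro z (h | h) ⟨hz, hzv⟩
      · exact hd hz (hann ⟨h, hz.2⟩) hzv
      · exact hd hz h.2 hzv
    · intro z hz
      by_cases hzr : z ∈ closedBall c r
      · exact Or.inl (Or.inl (closedBall_subset_ball (by simp [R, hδ]) hzr))
      · rcases hcov ⟨hz, hzr⟩ with h | h
        · exact Or.inl (Or.inr ⟨⟨hz, hzr⟩, h⟩)
        · exact Or.inr ⟨⟨hz, hzr⟩, h⟩
    · have hc : c ∈ ball c R := mem_ball_self (by positivity)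
      exact ⟨c, hthick hc, Or.inl hc⟩
  have hannΩ : ball c R \ closedBall c r ⊆ Ω \ closedBall c r := sdiff_subset_sdiff_left hthick
  rw [isPreconnected_iff_subset_of_disjoint]
  intro u v hu hv hcov hdisj
  rcases isPreconnected_iff_subset_of_disjoint.1 hannulus u v hu hv (hannΩ.trans hcov)
    (subset_empty_iff.1 ((inter_subset_inter_left _ hannΩ).trans hdisj.subset)) with h | h
  · exact Or.inl (key hu hv hcov hdisj h)
  · exact Or.inr (key hv hu (by rwa [union_comm]) (by rwa [inter_comm v u]) h)

theorem IsSchottkyFamily.sphere_subset {I : Type*} {Ω : Set ℂ} {c : I → ℂ} {r : I → ℝ}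
    (h : IsSchottkyFamily Ω c r) (i : I) :
    sphere (c i) (r i) ⊆ Ω \ ⋃ j, ball (c j) (r j) := by
  intro z hz
  refine ⟨h.2.1 i (sphere_subset_closedBall hz), ?_⟩
  rw [mem_iUnion]
  rintro ⟨j, hj⟩
  by_cases hij : i = j
  · subst hij
    exact (mem_ball.1 hj).ne hz
  · exact Set.disjoint_left.1 (h.2.2 hij) (sphere_subset_closedBall hz) (ball_subset_closedBall hj)

/-- A relative Schottky set is connected. -/
theorem IsSchottkyFamily.isPreconnected_diff {I : Type*} {Ω : Set ℂ} {c : I → ℂ} {r : I → ℝ}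
    (h : IsSchottkyFamily Ω c r) (hΩ : IsOpen Ω) (hconn : IsPreconnected Ω) :
    IsPreconnected (Ω \ ⋃ j, ball (c j) (r j)) := by
  rw [isPreconnected_iff_subset_of_disjoint]
  intro u v hu hv hcov hdisj
  set S := Ω \ ⋃ j, ball (c j) (r j) with hS
  let fill : Set ℂ → Set ℂ := fun w => S ∩ w ∪ ⋃ j ∈ {j | sphere (c j) (r j) ⊆ w}, ball (c j) (r j)
  have hsphere (j : I) : sphere (c j) (r j) ⊆ u ∨ sphere (c j) (r j) ⊆ v :=
    isPreconnected_iff_subset_of_disjoint.1 (isPreconnected_sphere_complex _ _) u v hu hv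
      ((h.sphere_subset j).trans hcov)
      (subset_empty_iff.1 ((inter_subset_inter_left _ (h.sphere_subset j)).trans hdisj.subset))
  have hd {z : ℂ} (hz : z ∈ S) (hzu : z ∈ u) : z ∉ v := fun hzv =>
    eq_empty_iff_forall_notMem.1 hdisj z ⟨hz, hzu, hzv⟩
  have hfill_open {u v : Set ℂ} (hu : IsOpen u) (hd : ∀ z ∈ S, z ∈ u → z ∉ v)
      (hsphere : ∀ j, sphere (c j) (r j) ⊆ u ∨ sphere (c j) (r j) ⊆ v) : IsOpen (fill u) := by
    rw [isOpen_iff_mem_nhds]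
    rintro z (⟨hzS, hzu⟩ | hz)
    · obtain ⟨ε, hε, hball⟩ := Metric.isOpen_iff.1 (hΩ.inter hu) z ⟨hzS.1, hzu⟩
      filter_upwards [ball_mem_nhds z hε] with y hy
      by_cases hyB : y ∈ ⋃ j, ball (c j) (r j)
      · obtain ⟨j, hj⟩ := mem_iUnion.1 hyB
        refine Or.inr (mem_biUnion (x := j) ?_ hj)
        obtain ⟨w, hwz, hw⟩ := ((convex_ball z ε).isPreconnected).inter_sphere_nonempty
          ⟨y, hy, hj⟩ fun hsub => hzS.2 (mem_iUnion.2 ⟨j, hsub (mem_ball_self hε)⟩)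
        exact (hsphere j).resolve_right fun hv =>
          hd w (h.sphere_subset j hw) (hball hwz).2 (hv hw)
      · exact Or.inl ⟨⟨(hball hy).1, hyB⟩, (hball hy).2⟩
    · refine mem_of_superset ?_ subset_union_right
      exact (isOpen_biUnion fun _ _ => isOpen_ball).mem_nhds hz
  have hfill_inter {w : Set ℂ} {z : ℂ} (hz : z ∈ S) (hzw : z ∈ fill w) : z ∈ w := by
    rcases hzw with hzw | hzw
    · exact hzw.2
    · obtain ⟨j, -, hj⟩ := mem_iUnion₂.1 hzw
      exact absurd (mem_iUnion.2 ⟨j, hj⟩) hz.2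
  have hcov' : Ω ⊆ fill u ∪ fill v := by
    intro z hz
    by_cases hzB : z ∈ ⋃ j, ball (c j) (r j)
    · obtain ⟨j, hj⟩ := mem_iUnion.1 hzB
      rcases hsphere j with hj' | hj'
      · exact Or.inl (Or.inr (mem_biUnion (x := j) hj' hj))
      · exact Or.inr (Or.inr (mem_biUnion (x := j) hj' hj))
    · rcases hcov ⟨hz, hzB⟩ with hz' | hz'
      · exact Or.inl (Or.inl ⟨⟨hz, hzB⟩, hz'⟩)
      · exact Or.inr (Or.inl ⟨⟨hz, hzB⟩, hz'⟩)
  have hdisj' : Ω ∩ (fill u ∩ fill v) = ∅ := by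
    rw [eq_empty_iff_forall_notMem]
    rintro z ⟨hz, hzu, hzv⟩
    by_cases hzB : z ∈ ⋃ j, ball (c j) (r j)
    · rcases hzu with hzu | hzu
      · exact hzu.1.2 hzB
      rcases hzv with hzv | hzv
      · exact hzv.1.2 hzB
      obtain ⟨j, hj, hzj⟩ := mem_iUnion₂.1 hzu
      obtain ⟨k, hk, hzk⟩ := mem_iUnion₂.1 hzv
      obtain rfl : j = k := by
        by_contra hjk
        exact Set.disjoint_left.1 (h.2.2 hjk) (ball_subset_closedBall hzj)
          (ball_subset_closedBall hzk)
      obtain ⟨w, hw⟩ : (sphere (c j) (r j)).Nonempty := NormedSpace.sphere_nonempty.2 (h.1 j).le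
      exact hd (h.sphere_subset j hw) (hj hw) (hk hw)
    · exact hd ⟨hz, hzB⟩ (hfill_inter ⟨hz, hzB⟩ hzu) (hfill_inter ⟨hz, hzB⟩ hzv)
  refine (isPreconnected_iff_subset_of_disjoint.1 hconn (fill u) (fill v)
    (hfill_open hu (fun z => hd) hsphere)
    (hfill_open hv (fun z hz hzv hzu => hd hz hzu hzv) fun j => (hsphere j).symm)
    hcov' hdisj').imp ?_ ?_ <;>
  exact fun hsub z hz => hfill_inter hz (hsub hz.1)

/-- A peripheral circle does not separate a relative Schottky set. -/
theorem IsSchottkyFamily.isPreconnected_diff_sphere {I : Type*} {Ω : Set ℂ} {c : I → ℂ}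
    {r : I → ℝ} (h : IsSchottkyFamily Ω c r) (hΩ : IsOpen Ω) (hconn : IsPreconnected Ω) (i : I) :
    IsPreconnected ((Ω \ ⋃ j, ball (c j) (r j)) \ sphere (c i) (r i)) := by
  have hfam : IsSchottkyFamily (Ω \ closedBall (c i) (r i))
      (fun j : {j // j ≠ i} => c j) (fun j => r j) :=
    ⟨fun j => h.1 j, fun j => subset_sdiff.2 ⟨h.2.1 j, h.2.2 j.2⟩,
      fun j k hjk => h.2.2 fun hjk' => hjk (Subtype.ext hjk')⟩
  convert hfam.isPreconnected_diff (hΩ.sdiff isClosed_closedBall)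
    (hconn.diff_closedBall hΩ (h.1 i) (h.2.1 i)) using 1
  ext z
  simp only [Set.mem_sdiff, mem_iUnion, Subtype.exists, not_exists, ← ball_union_sphere, mem_union,
    not_or]
  constructor
  · rintro ⟨⟨hz, hzB⟩, hzi⟩
    exact ⟨⟨hz, hzB i, hzi⟩, fun j _ => hzB j⟩
  · rintro ⟨⟨hz, hzb, hzi⟩, hzB⟩
    refine ⟨⟨hz, fun j => ?_⟩, hzi⟩
    by_cases hji : j = i
    · rwa [hji]
    · exact hzB j hji

/-- A closed set in a relative Schottky set which separates the plane, but not the Schottky set,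
contains a peripheral circle. -/
theorem IsSchottkyFamily.exists_sphere_subset {J : Type*} {Ω : Set ℂ} {c : J → ℂ} {r : J → ℝ}
    (h : IsSchottkyFamily Ω c r) (hΩ : IsOpen Ω) {Γ : Set ℂ} (hΓ : IsClosed Γ)
    (hsub : Γ ⊆ Ω \ ⋃ j, ball (c j) (r j)) (hsep : ¬ IsPreconnected Γᶜ)
    (hconn : IsPreconnected ((Ω \ ⋃ j, ball (c j) (r j)) \ Γ)) :
    ∃ j, sphere (c j) (r j) ⊆ Γ := by
  set S := Ω \ ⋃ j, ball (c j) (r j) with hS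
  obtain ⟨V, hVne, hVuniv, hVopen, hVS, hVfr⟩ : ∃ V : Set ℂ, V.Nonempty ∧ V ≠ univ ∧ IsOpen V ∧
      Disjoint V S ∧ frontier V ⊆ Γ := by
    have key {u v : Set ℂ} (hu : IsOpen u) (hv : IsOpen v) (hcov : Γᶜ ⊆ u ∪ v)
        (hdisj : Γᶜ ∩ (u ∩ v) = ∅) (hnu : ¬ Γᶜ ⊆ u) (hnv : ¬ Γᶜ ⊆ v) (hSu : S \ Γ ⊆ u) :
        ∃ V : Set ℂ, V.Nonempty ∧ V ≠ univ ∧ IsOpen V ∧ Disjoint V S ∧ frontier V ⊆ Γ := by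
      have hd {z : ℂ} (hz : z ∉ Γ) (hzu : z ∈ u) : z ∉ v := fun hzv =>
        eq_empty_iff_forall_notMem.1 hdisj z ⟨hz, hzu, hzv⟩
      obtain ⟨x, hx, hxu⟩ := not_subset.1 hnu
      obtain ⟨y, hy, hyv⟩ := not_subset.1 hnv
      refine ⟨Γᶜ ∩ v, ⟨x, hx, (hcov hx).resolve_left hxu⟩, fun huniv => hyv ?_,
        hΓ.isOpen_compl.inter hv, ?_, fun z hz => ?_⟩
      · exact (huniv ▸ mem_univ y : y ∈ Γᶜ ∩ v).2
      · rw [Set.disjoint_left]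
        exact fun z hz hzS => hd hz.1 (hSu ⟨hzS, hz.1⟩) hz.2
      · by_contra hzΓ
        rw [(hΓ.isOpen_compl.inter hv).frontier_eq] at hz
        have hzu : z ∈ u := (hcov hzΓ).resolve_right fun hzv => hz.2 ⟨hzΓ, hzv⟩
        obtain ⟨w, hwu, hwv⟩ := mem_closure_iff.1 hz.1 u hu hzu
        exact hd hwv.1 hwu hwv.2
    rw [isPreconnected_iff_subset_of_disjoint] at hsep
    push Not at hsep
    obtain ⟨u, v, hu, hv, hcov, hdisj, hnu, hnv⟩ := hsep
    have hSΓ : S \ Γ ⊆ Γᶜ := fun z hz => hz.2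
    rcases isPreconnected_iff_subset_of_disjoint.1 hconn u v hu hv (hSΓ.trans hcov)
      (subset_empty_iff.1 ((inter_subset_inter_left _ hSΓ).trans hdisj.subset)) with hs | hs
    · exact key hu hv hcov hdisj hnu hnv hs
    · exact key hv hu (by rwa [union_comm]) (by rwa [inter_comm v u]) hnv hnu hs
  have hVfr' : closure V \ V ⊆ Γ := hVopen.frontier_eq ▸ hVfr
  by_cases hmeet : ∃ j, (V ∩ ball (c j) (r j)).Nonempty
  · obtain ⟨j, x, hxV, hxj⟩ := hmeet
    refine ⟨j, fun z hz => hVfr' ⟨?_, Set.disjoint_right.1 hVS (h.sphere_subset j hz)⟩⟩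
    have hball : ball (c j) (r j) ⊆ V := by
      refine (convex_ball (c j) (r j)).isPreconnected.subset_of_closure_inter_subset hVopen
        ⟨x, hxj, hxV⟩ fun y hy => ?_
      by_contra hyV
      exact (hsub (hVfr' ⟨hy.1, hyV⟩)).2 (mem_iUnion.2 ⟨j, hy.2⟩)
    refine closure_mono hball ?_
    rw [closure_ball _ (h.1 j).ne']
    exact sphere_subset_closedBall hz
  · push Not at hmeet
    obtain ⟨z, hz⟩ := nonempty_frontier_iff.2 ⟨hVne, hVuniv⟩
    obtain ⟨w, hwΩ, hwV⟩ := mem_closure_iff.1 (frontier_subset_closure hz) Ω hΩ (hsub (hVfr hz)).1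
    refine absurd (⟨hwΩ, fun hw => ?_⟩ : w ∈ S) (Set.disjoint_left.1 hVS hwV)
    obtain ⟨j, hj⟩ := mem_iUnion.1 hw
    exact eq_empty_iff_forall_notMem.1 (hmeet j) w ⟨hwV, hj⟩

/-- A homeomorphism between relative Schottky sets maps every peripheral
circle onto a peripheral circle. -/
theorem schottky_homeo_maps_peripheral_circles
    (Ω Ωt : Set ℂ) {I J : Type} (c : I → ℂ) (r : I → ℝ) (ct : J → ℂ) (rt : J → ℝ)
    (hΩ : IsPlaneDomain Ω) (hΩt : IsPlaneDomain Ωt)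
    (hfam : IsSchottkyFamily Ω c r) (hfamt : IsSchottkyFamily Ωt ct rt)
    (S St : Set ℂ)
    (hS : S = Ω \ ⋃ i, ball (c i) (r i))
    (hSt : St = Ωt \ ⋃ j, ball (ct j) (rt j))
    (f : ℂ → ℂ) (hf : IsHomeoOn f S St) :
    ∀ i, ∃ j, f '' sphere (c i) (r i) = sphere (ct j) (rt j) := by
  obtain ⟨e, he⟩ := hf
  intro i
  have hcont : ContinuousOn f S := by
    rw [continuousOn_iff_continuous_domRestrict]
    exact (continuous_subtype_val.comp e.continuous).congr he
  have hinj : InjOn f S := fun z hz w hw hzw => by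
    have := e.injective (Subtype.ext ((he ⟨z, hz⟩).trans (hzw.trans (he ⟨w, hw⟩).symm)))
    exact congrArg Subtype.val this
  have himage : f '' S = St := by
    ext w
    constructor
    · rintro ⟨z, hz, rfl⟩
      exact he ⟨z, hz⟩ ▸ (e ⟨z, hz⟩).2
    · intro hw
      exact ⟨e.symm ⟨w, hw⟩, (e.symm ⟨w, hw⟩).2, by rw [← he, e.apply_symm_apply]⟩
  have hsphere : sphere (c i) (r i) ⊆ S := hS ▸ hfam.sphere_subset i
  have hΓcont := hcont.mono hsphere
  have hΓinj := hinj.mono hsphere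
  have hΓSt : f '' sphere (c i) (r i) ⊆ St := himage ▸ image_mono hsphere
  obtain ⟨j, hj⟩ := hfamt.exists_sphere_subset hΩt.1
    ((isCompact_sphere (c i) (r i)).image_of_continuousOn hΓcont).isClosed (hSt ▸ hΓSt)
    (not_isPreconnected_compl_image_sphere (hfam.1 i) hΓcont hΓinj) (by
      rw [← hSt, ← himage, ← hinj.image_sdiff_subset hsphere]
      refine IsPreconnected.image ?_ f (hcont.mono sdiff_subset)
      rw [hS]
      exact hfam.isPreconnected_diff_sphere hΩ.1 hΩ.2.isPreconnected i)
  refine ⟨j, Subset.antisymm ?_ hj⟩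
  let g : ℂ → ℂ := Function.invFunOn f S
  have hgf : LeftInvOn g f S := hinj.leftInvOn_invFunOn
  have hgcont : ContinuousOn g St := by
    rw [continuousOn_iff_continuous_domRestrict]
    refine (continuous_subtype_val.comp e.symm.continuous).congr fun w => ?_
    have := hgf (e.symm w).2
    rw [← he, e.apply_symm_apply] at this
    exact this.symm
  have hspheret : sphere (ct j) (rt j) ⊆ St := hSt ▸ hfamt.sphere_subset j
  have hginj : InjOn g St := himage ▸ (hgf.rightInvOn_image).injOn
  have hgmaps : MapsTo g (sphere (ct j) (rt j)) (sphere (c i) (r i)) := by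
    intro w hw
    obtain ⟨z, hz, rfl⟩ := hj hw
    rwa [hgf (hsphere hz)]
  rintro _ ⟨z, hz, rfl⟩
  obtain ⟨w, hw, rfl⟩ := sphere_subset_image_of_injOn (hfamt.1 j) (hfam.1 i)
    (hgcont.mono hspheret) (hginj.mono hspheret) hgmaps hz
  obtain ⟨z, hz', rfl⟩ := hj hw
  rwa [hgf (hsphere hz')]
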